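/- arXiv:1106.4195 — 2 statements merged into one kernel-verified Lean document; each statement's English description precedes it below -/
import Mathlib

section
/- Fix n ∈ ℕ and work in the polynomial ring MvPolynomial (Fin n) ℚ with variables X_0, …, X_{n−1}. Let Q' = Π_{j=0}^{n−1} (1 + X_j)·(1 − X_j/2 + X_j²/3 − X_j³/4) and let e_1, e_2, e_3 denote the elementary symmetric polynomials in X_0, …, X_{n−1}. Then the homogeneous component of Q' of degree 0 equals 1, the homogeneous component of degree 1 equals e_1/2, the homogeneous component of degree 2 equals (−2e_1² + 7e_2)/12, and the homogeneous component of degree 3 equals (2e_1³ − 8e_1e_2 + 15e_3)/24. -/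
open MvPolynomial

/-- Pascal-type recursion for the elementary symmetric functions of a multiset. -/
theorem Multiset.esymm_cons_succ {R : Type*} [CommSemiring R] (a : R) (s : Multiset R) (n : ℕ) :
    (a ::ₘ s).esymm (n + 1) = s.esymm (n + 1) + a * s.esymm n := by
  simp [Multiset.esymm, Multiset.powersetCard_cons, Multiset.sum_map_mul_left]

theorem MvPolynomial.homogeneousComponent_zero_X_mul {σ R : Type*} [CommSemiring R] (i : σ)
    (p : MvPolynomial σ R) : homogeneousComponent 0 (X i * p) = 0 := by
  classical
  simp [homogeneousComponent_zero, coeff_X_mul']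

theorem MvPolynomial.homogeneousComponent_succ_X_mul {σ R : Type*} [CommSemiring R] (k : ℕ)
    (i : σ) (p : MvPolynomial σ R) :
    homogeneousComponent (k + 1) (X i * p) = X i * homogeneousComponent k p := by
  classical
  ext d
  simp only [coeff_homogeneousComponent, coeff_X_mul']
  by_cases hi : i ∈ d.support
  · have hd : d.degree = (d - Finsupp.single i 1).degree + 1 := by
      conv_lhs => rw [← tsub_add_cancel_of_le (Finsupp.single_le_iff.2
        (Nat.one_le_iff_ne_zero.2 (Finsupp.mem_support_iff.1 hi)))]
      simp [map_add]
    simp only [hi, if_true, hd, Nat.add_right_cancel_iff]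
  · simp [hi]

/-- The components of degree at most 3 of `∏ (1 + X_j)(1 - X_j/2 + X_j²/3 - X_j³/4)` over a finite
set of variables, in terms of the elementary symmetric functions of these variables. -/
theorem homogeneousComponent_prod_psi_factor {σ : Type*} (s : Finset σ) :
    let P : MvPolynomial σ ℚ :=
      ∏ j ∈ s,
        (1 + X j) *
          (1 - C (1 / 2 : ℚ) * X j + C (1 / 3 : ℚ) * X j ^ 2 - C (1 / 4 : ℚ) * X j ^ 3)
    let e : ℕ → MvPolynomial σ ℚ := (s.val.map X).esymm
    homogeneousComponent 0 P = 1 ∧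
    homogeneousComponent 1 P = C (1 / 2 : ℚ) * e 1 ∧
    homogeneousComponent 2 P = C (1 / 12 : ℚ) * (-2 * e 1 ^ 2 + 7 * e 2) ∧
    homogeneousComponent 3 P =
      C (1 / 24 : ℚ) * (2 * e 1 ^ 3 - 8 * e 1 * e 2 + 15 * e 3) := by
  classical
  induction s using Finset.induction_on with
  | empty =>
    have h (k : ℕ) : homogeneousComponent (k + 1) (1 : MvPolynomial σ ℚ) = 0 :=
      homogeneousComponent_eq_zero _ _ (by simp)
    have h0 (k : ℕ) : (0 : Multiset (MvPolynomial σ ℚ)).esymm (k + 1) = 0 := by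
      simp [Multiset.esymm, Multiset.powersetCard_zero_right]
    simp [homogeneousComponent_zero, h 0, h 1, h 2, h0 0, h0 1, h0 2]
  | insert a s ha ih =>
    obtain ⟨h0, h1, h2, h3⟩ := ih
    intro P e
    set p : MvPolynomial σ ℚ := ∏ j ∈ s, (1 + X j) *
      (1 - C (1 / 2 : ℚ) * X j + C (1 / 3 : ℚ) * X j ^ 2 - C (1 / 4 : ℚ) * X j ^ 3)
    set f : ℕ → MvPolynomial σ ℚ := (s.val.map X).esymm
    have he (k : ℕ) : e (k + 1) = f (k + 1) + X a * f k := by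
      simp only [e, f, Finset.insert_val_of_notMem ha, Multiset.map_cons,
        Multiset.esymm_cons_succ]
    have hf : f 0 = 1 := by simp [f, Multiset.esymm]
    have hP : P = p + C (1 / 2 : ℚ) * (X a * p) + C (-1 / 6 : ℚ) * (X a * (X a * p)) +
        C (1 / 12 : ℚ) * (X a * (X a * (X a * p))) +
        C (-1 / 4 : ℚ) * (X a * (X a * (X a * (X a * p)))) := by
      simp only [P, Finset.prod_insert ha]
      change _ * p = _
      rw [show (-1 / 6 : ℚ) = 1 / 3 - 1 / 2 by norm_num,
        show (1 / 12 : ℚ) = 1 / 3 - 1 / 4 by norm_num,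
        show (-1 / 4 : ℚ) = -(1 / 4) by norm_num]
      have h : C (1 / 2 : ℚ) = 1 - (C (1 / 2 : ℚ) : MvPolynomial σ ℚ) := by
        rw [← C_1, ← C_sub]; norm_num
      simp only [C_sub, C_neg]
      linear_combination (-X a * p) * h
    have hu (q : ℚ) (m : ℤ) (h : q = m * (1 / 24)) :
        (C q : MvPolynomial σ ℚ) = (m : MvPolynomial σ ℚ) * C (1 / 24 : ℚ) := by
      rw [h, C_mul, map_intCast]
    have h24 : 24 * C (1 / 24 : ℚ) = (1 : MvPolynomial σ ℚ) := by
      simpa using (hu 1 24 (by norm_num)).symm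
    have c2 := hu (1 / 2) 12 (by norm_num)
    have c6 := hu (-1 / 6) (-4) (by norm_num)
    have c12 := hu (1 / 12) 2 (by norm_num)
    push_cast at c2 c6 c12
    simp only [hP, map_add, homogeneousComponent_C_mul, homogeneousComponent_zero_X_mul,
      homogeneousComponent_succ_X_mul 0, homogeneousComponent_succ_X_mul 1,
      homogeneousComponent_succ_X_mul 2, h0, h1, h2, h3, he 0, he 1, he 2, hf, zero_add,
      Nat.reduceAdd]
    simp only [c2, c6, c12]
    refine ⟨by ring, by ring, ?_, ?_⟩
    · linear_combination 6 * C (1 / 24 : ℚ) * X a * f 1 * h24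
    · linear_combination C (1 / 24 : ℚ) *
        (X a * (-2 * f 1 ^ 2 + 7 * f 2) - 2 * X a ^ 2 * f 1) * h24

/-- In `MvPolynomial (Fin n) ℚ`, let `Q' = Π_j (1 + X_j)·(1 − X_j/2 + X_j²/3 − X_j³/4)`. Its
homogeneous components of degrees 0,1,2,3 are `1`, `e₁/2`, `(−2e₁² + 7e₂)/12` and
`(2e₁³ − 8e₁e₂ + 15e₃)/24`. -/
theorem homogeneous_components_of_psi_product (n : ℕ) :
    let Q' : MvPolynomial (Fin n) ℚ :=
      ∏ j : Fin n,
        (1 + X j) *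
          (1 - C (1 / 2 : ℚ) * X j + C (1 / 3 : ℚ) * X j ^ 2 - C (1 / 4 : ℚ) * X j ^ 3)
    homogeneousComponent 0 Q' = 1 ∧
    homogeneousComponent 1 Q' = C (1 / 2 : ℚ) * esymm (Fin n) ℚ 1 ∧
    homogeneousComponent 2 Q' =
      C (1 / 12 : ℚ) * (-2 * esymm (Fin n) ℚ 1 ^ 2 + 7 * esymm (Fin n) ℚ 2) ∧
    homogeneousComponent 3 Q' =
      C (1 / 24 : ℚ) *
        (2 * esymm (Fin n) ℚ 1 ^ 3 - 8 * esymm (Fin n) ℚ 1 * esymm (Fin n) ℚ 2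
          + 15 * esymm (Fin n) ℚ 3) := by
  simpa only [esymm_eq_multiset_esymm] using homogeneousComponent_prod_psi_factor Finset.univ
end

section
/- Let H = ℓ²(ℤ³; ℂ²) be the Hilbert space of square–summable ℂ²-valued sequences indexed by ℤ³. Let g be the matrix [[2,1,0],[1,1,0],[0,0,1]], which has determinant 1 and hence induces a bijection of ℤ³. Define p : ℤ³ → Mat_2(ℂ) by p(0) = 0 and p(k) = (I_2 + c(k/|k|))/2 for k ≠ 0. Define the bounded operators P, T : H → H by (Pa)_k = p(k)·a_k and (Ta)_m = a_{g⁻¹m}. Then P is an orthogonal projection, T is unitary, and the bounded operator D₁ = P·T·P + (1 − P) on H is invertible (a bijection with bounded inverse). -/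
open Matrix

/-- The Pauli matrix `c₁ = [[0,1],[1,0]]`. -/
def pauli1 : Matrix (Fin 2) (Fin 2) ℂ := !![0, 1; 1, 0]

/-- The Pauli matrix `c₂ = [[0,−i],[i,0]]`. -/
def pauli2 : Matrix (Fin 2) (Fin 2) ℂ := !![0, -Complex.I; Complex.I, 0]

/-- The Pauli matrix `c₃ = [[1,0],[0,−1]]`. -/
def pauli3 : Matrix (Fin 2) (Fin 2) ℂ := !![1, 0; 0, -1]

/-- For `ξ ∈ ℝ³`, the Clifford symbol `c(ξ) = ξ₁·c₁ + ξ₂·c₂ + ξ₃·c₃`. -/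
noncomputable def cliff (ξ : Fin 3 → ℝ) : Matrix (Fin 2) (Fin 2) ℂ :=
  (ξ 0 : ℂ) • pauli1 + (ξ 1 : ℂ) • pauli2 + (ξ 2 : ℂ) • pauli3

/-- The Euclidean norm on `ℝ³`. -/
noncomputable def enorm3 (ξ : Fin 3 → ℝ) : ℝ := Real.sqrt (ξ 0 ^ 2 + ξ 1 ^ 2 + ξ 2 ^ 2)

/-- `p : ℤ³ → Mat₂(ℂ)`, `p(0) = 0` and `p(k) = (I₂ + c(k/|k|))/2` for `k ≠ 0`. -/
noncomputable def diracProj (k : Fin 3 → ℤ) : Matrix (Fin 2) (Fin 2) ℂ :=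
  if k = 0 then 0
  else (2⁻¹ : ℂ) • (1 + cliff ((enorm3 fun i => (k i : ℝ))⁻¹ • fun i => (k i : ℝ)))

/-- The cat-map matrix `g = [[2,1,0],[1,1,0],[0,0,1]]` over `ℤ`. -/
def gmatZ : Matrix (Fin 3) (Fin 3) ℤ := !![2, 1, 0; 1, 1, 0; 0, 0, 1]

/-- The Hilbert space `H = ℓ²(ℤ³; ℂ²)`. -/
abbrev H : Type :=
  lp (fun _ : Fin 3 → ℤ => EuclideanSpace ℂ (Fin 2)) 2

section Clifford

lemma cliff_conjTranspose (x : Fin 3 → ℝ) : (cliff x)ᴴ = cliff x := by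
  ext i j
  fin_cases i <;> fin_cases j <;> simp [cliff, pauli1, pauli2, pauli3]

lemma cliff_mul_add_mul (x y : Fin 3 → ℝ) :
    cliff x * cliff y + cliff y * cliff x = ((2 * (x ⬝ᵥ y) : ℝ) : ℂ) • 1 := by
  ext i j
  fin_cases i <;> fin_cases j <;>
    simp [cliff, pauli1, pauli2, pauli3, Fin.sum_univ_succ, dotProduct] <;>
    ring_nf <;> simp

lemma cliff_mul_self {x : Fin 3 → ℝ} (hx : x ⬝ᵥ x = 1) : cliff x * cliff x = 1 := by
  have h := cliff_mul_add_mul x x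
  rw [hx, ← two_smul ℂ (cliff x * cliff x)] at h
  refine smul_right_injective _ (two_ne_zero (α := ℂ)) ?_
  simpa using h

lemma half_one_add_mul_mul {A : Type*} [Ring A] [Algebra ℂ A] {a b : A} {t : ℂ}
    (ha : a * a = 1) (hab : a * b + b * a = (2 * t) • 1) :
    ((2⁻¹ : ℂ) • (1 + a)) * ((2⁻¹ : ℂ) • (1 + b)) * ((2⁻¹ : ℂ) • (1 + a)) =
      ((1 + t) / 2) • ((2⁻¹ : ℂ) • (1 + a)) := by
  have haba : a * b * a = (2 * t) • a - b := by
    rw [eq_sub_of_add_eq hab, sub_mul, smul_mul_assoc, one_mul, mul_assoc, ha, mul_one]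
  have h : (1 + a) * (1 + b) * (1 + a) = (2 * (1 + t)) • (1 + a) := by
    calc (1 + a) * (1 + b) * (1 + a)
        = 1 + a + a + a * a + b + (a * b + b * a) + a * b * a := by noncomm_ring
      _ = (2 * (1 + t)) • (1 + a) := by rw [ha, hab, haba]; module
  simp only [smul_mul_assoc, mul_smul_comm, h, smul_smul]
  congr 1
  ring

/-- The unit vector in the direction of a lattice point. -/
noncomputable def latticeDir (k : Fin 3 → ℤ) : Fin 3 → ℝ :=
  (enorm3 fun i => (k i : ℝ))⁻¹ • fun i => (k i : ℝ)

lemma diracProj_of_ne_zero {k : Fin 3 → ℤ} (hk : k ≠ 0) :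
    diracProj k = (2⁻¹ : ℂ) • (1 + cliff (latticeDir k)) := if_neg hk

lemma latticeDir_dotProduct_self {k : Fin 3 → ℤ} (hk : k ≠ 0) :
    latticeDir k ⬝ᵥ latticeDir k = 1 := by
  have h0 : (0 : ℝ) < (k 0 : ℝ) ^ 2 + (k 1 : ℝ) ^ 2 + (k 2 : ℝ) ^ 2 := by
    by_contra! h
    apply hk
    have s0 := sq_nonneg (k 0 : ℝ)
    have s1 := sq_nonneg (k 1 : ℝ)
    have s2 := sq_nonneg (k 2 : ℝ)
    have h0 : (k 0 : ℝ) ^ 2 = 0 := by linarith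
    have h1 : (k 1 : ℝ) ^ 2 = 0 := by linarith
    have h2 : (k 2 : ℝ) ^ 2 = 0 := by linarith
    ext i
    fin_cases i <;> simp_all
  have hs := Real.sq_sqrt h0.le
  have hne : enorm3 (fun i => (k i : ℝ)) ≠ 0 := (Real.sqrt_pos.2 h0).ne'
  change enorm3 (fun i => (k i : ℝ)) ^ 2 = _ at hs
  simp only [latticeDir, dotProduct, Fin.sum_univ_three, Pi.smul_apply, smul_eq_mul]
  field_simp
  exact hs.symm

lemma latticeDir_dotProduct_nonneg {k l : Fin 3 → ℤ} (h : 0 ≤ k ⬝ᵥ l) :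
    0 ≤ latticeDir k ⬝ᵥ latticeDir l := by
  rw [latticeDir, latticeDir, smul_dotProduct, dotProduct_smul]
  have h' : (0 : ℝ) ≤ (fun i => (k i : ℝ)) ⬝ᵥ fun i => (l i : ℝ) := by
    have := Int.cast_nonneg (R := ℝ) h
    simpa [dotProduct] using this
  exact mul_nonneg (inv_nonneg.2 (Real.sqrt_nonneg _))
    (mul_nonneg (inv_nonneg.2 (Real.sqrt_nonneg _)) h')

lemma isStarProjection_diracProj (k : Fin 3 → ℤ) : IsStarProjection (diracProj k) := by
  by_cases hk : k = 0
  · simp [diracProj, hk, IsStarProjection.zero]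
  rw [diracProj_of_ne_zero hk]
  refine ⟨?_, ?_⟩
  · have h := cliff_mul_self (latticeDir_dotProduct_self hk)
    rw [IsIdempotentElem, smul_mul_smul_comm]
    have h' : (1 + cliff (latticeDir k)) * (1 + cliff (latticeDir k)) =
        (2 : ℂ) • (1 + cliff (latticeDir k)) := by
      rw [mul_add, add_mul, add_mul, h]
      simp only [one_mul, mul_one]
      module
    rw [h', smul_smul]
    norm_num
  · rw [IsSelfAdjoint, Matrix.star_eq_conjTranspose, conjTranspose_smul, conjTranspose_add,
      cliff_conjTranspose]
    simp

/-- Compressing one Dirac projection by another at a non-obtuse angle scales by at least `1/2`. -/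
lemma exists_diracProj_mul_mul {k l : Fin 3 → ℤ} (hkl : l = 0 → k = 0) (h : 0 ≤ k ⬝ᵥ l) :
    ∃ w : ℝ, 1 / 2 ≤ w ∧ diracProj k * diracProj l * diracProj k = (w : ℂ) • diracProj k := by
  by_cases hk : k = 0
  · exact ⟨1, by norm_num, by simp [diracProj, hk]⟩
  have hl : l ≠ 0 := fun hl => hk (hkl hl)
  refine ⟨(1 + latticeDir k ⬝ᵥ latticeDir l) / 2, ?_, ?_⟩
  · linarith [latticeDir_dotProduct_nonneg h]
  · rw [diracProj_of_ne_zero hk, diracProj_of_ne_zero hl,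
      half_one_add_mul_mul (t := ((latticeDir k ⬝ᵥ latticeDir l : ℝ) : ℂ))
        (cliff_mul_self (latticeDir_dotProduct_self hk))
        (by simpa using cliff_mul_add_mul (latticeDir k) (latticeDir l))]
    push_cast
    rfl

end Clifford

section Shift

variable {ι E : Type*} [NormedAddCommGroup E] [InnerProductSpace ℂ E]

/-- Reindexing of square-summable sequences along a permutation, as a linear isometry. -/
noncomputable def lpShift (σ : Equiv.Perm ι) :
    lp (fun _ : ι => E) 2 →ₗᵢ[ℂ] lp (fun _ : ι => E) 2 where
  toFun a := ⟨fun i => a (σ i),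
    memℓp_gen (((lp.memℓp a).summable (by simp)).comp_injective σ.injective)⟩
  map_add' _ _ := rfl
  map_smul' _ _ := rfl
  norm_map' a := by
    have hp : 0 < (2 : ENNReal).toReal := by simp
    rw [lp.norm_eq_tsum_rpow hp, lp.norm_eq_tsum_rpow hp]
    congr 1
    exact σ.tsum_eq fun i => ‖a i‖ ^ (2 : ENNReal).toReal

/-- The shift `lpShift` as a bounded operator. -/
noncomputable def shiftCLM (σ : Equiv.Perm ι) :
    lp (fun _ : ι => E) 2 →L[ℂ] lp (fun _ : ι => E) 2 :=
  (lpShift σ).toContinuousLinearMap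

@[simp] lemma shiftCLM_apply (σ : Equiv.Perm ι) (a : lp (fun _ : ι => E) 2) (i : ι) :
    shiftCLM σ a i = a (σ i) := rfl

lemma shiftCLM_mul_inv (σ : Equiv.Perm ι) :
    shiftCLM (E := E) σ * shiftCLM σ⁻¹ = 1 := by
  ext a i
  simp

lemma shiftCLM_inv_mul (σ : Equiv.Perm ι) :
    shiftCLM (E := E) σ⁻¹ * shiftCLM σ = 1 := by
  ext a i
  simp

lemma star_shiftCLM [CompleteSpace E] (σ : Equiv.Perm ι) :
    star (shiftCLM (E := E) σ) = shiftCLM σ⁻¹ := by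
  refine ((ContinuousLinearMap.eq_adjoint_iff _ _).2 fun x y => ?_).symm
  rw [lp.inner_eq_tsum, lp.inner_eq_tsum, ← σ.tsum_eq]
  simp

lemma shiftCLM_mem_unitary [CompleteSpace E] (σ : Equiv.Perm ι) :
    shiftCLM (E := E) σ ∈ unitary (lp (fun _ : ι => E) 2 →L[ℂ] lp (fun _ : ι => E) 2) := by
  rw [Unitary.mem_iff, star_shiftCLM]
  exact ⟨shiftCLM_inv_mul σ, shiftCLM_mul_inv σ⟩

variable [CompleteSpace E] {p : ι → E →L[ℂ] E}

/-- The operator acting on each coordinate by a projection. -/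
noncomputable def diagProj (hp : ∀ i, IsStarProjection (p i)) :
    lp (fun _ : ι => E) 2 →L[ℂ] lp (fun _ : ι => E) 2 :=
  lp.mapCLM 2 p zero_le_one fun i => (hp i).norm_le

@[simp] lemma diagProj_apply (hp : ∀ i, IsStarProjection (p i)) (a : lp (fun _ : ι => E) 2)
    (i : ι) : diagProj hp a i = p i (a i) := rfl

lemma isStarProjection_diagProj (hp : ∀ i, IsStarProjection (p i)) :
    IsStarProjection (diagProj hp) := by
  refine ⟨?_, ?_⟩
  · ext a i
    exact DFunLike.congr_fun (hp i).isIdempotentElem.eq (a i)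
  · refine ((ContinuousLinearMap.eq_adjoint_iff _ _).2 fun x y => ?_).symm
    rw [lp.inner_eq_tsum, lp.inner_eq_tsum]
    congr 1 with i
    exact (hp i).isSelfAdjoint.isSymmetric (x i) (y i)

/-- The compression of a shift by a diagonal projection, extended by the identity. -/
noncomputable def compressedShift (hp : ∀ i, IsStarProjection (p i)) (σ : Equiv.Perm ι) :
    lp (fun _ : ι => E) 2 →L[ℂ] lp (fun _ : ι => E) 2 :=
  diagProj hp * shiftCLM σ * diagProj hp + (1 - diagProj hp)

lemma isUnit_compressedShift_inv_mul (hp : ∀ i, IsStarProjection (p i)) (σ : Equiv.Perm ι)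
    (h : ∀ i, ∃ w : ℝ, 1 / 2 ≤ w ∧ p i * p (σ⁻¹ i) * p i = (w : ℂ) • p i) :
    IsUnit (compressedShift hp σ⁻¹ * compressedShift hp σ) := by
  choose w hw hpw using h
  have hw0 (i : ι) : (w i : ℂ) ≠ 0 := by
    have := hw i
    exact_mod_cast (by linarith : (0 : ℝ) < w i).ne'
  have hpp (i : ι) (x : E) : p i (p i x) = p i x :=
    DFunLike.congr_fun (hp i).isIdempotentElem.eq x
  have hpqp (i : ι) (x : E) : p i (p (σ.symm i) (p i x)) = (w i : ℂ) • p i x :=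
    DFunLike.congr_fun (hpw i) x
  have hbound (i : ι) : ‖((w i : ℂ)⁻¹ - 1) • p i + 1‖ ≤ 4 := by
    have h1 : ‖(w i : ℂ)⁻¹‖ ≤ 2 := by
      rw [norm_inv, Complex.norm_real, Real.norm_of_nonneg (by linarith [hw i])]
      exact inv_le_of_inv_le₀ (by norm_num) (by linarith [hw i])
    have h2 : ‖(w i : ℂ)⁻¹ - 1‖ ≤ 3 := (norm_sub_le _ _).trans (by rw [norm_one]; linarith)
    calc ‖((w i : ℂ)⁻¹ - 1) • p i + 1‖ ≤ ‖(w i : ℂ)⁻¹ - 1‖ * ‖p i‖ + 1 :=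
          (norm_add_le _ _).trans (add_le_add (norm_smul_le _ _) ContinuousLinearMap.norm_id_le)
      _ ≤ 3 * 1 + 1 := by gcongr; exact (hp i).norm_le
      _ = 4 := by norm_num
  have happ (a : lp (fun _ : ι => E) 2) (i : ι) :
      (compressedShift hp σ⁻¹ * compressedShift hp σ) a i = ((w i : ℂ) - 1) • p i (a i) + a i := by
    simp [compressedShift, hpp, hpqp, -Complex.coe_smul]
    module
  refine isUnit_iff_exists.2 ⟨lp.mapCLM 2 _ (by norm_num) hbound, ?_, ?_⟩
  · ext a i
    rw [mul_apply_eq_comp, happ]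
    change ((w i : ℂ) - 1) • p i (((w i : ℂ)⁻¹ - 1) • p i (a i) + a i) +
      (((w i : ℂ)⁻¹ - 1) • p i (a i) + a i) = a i
    rw [map_add, map_smul, hpp]
    match_scalars <;> field [hw0 i]
  · ext a i
    change ((w i : ℂ)⁻¹ - 1) • p i ((compressedShift hp σ⁻¹ * compressedShift hp σ) a i) +
      (compressedShift hp σ⁻¹ * compressedShift hp σ) a i = a i
    rw [happ, map_add, map_smul, hpp]
    match_scalars <;> field [hw0 i]

lemma isUnit_compressedShift (hp : ∀ i, IsStarProjection (p i)) (σ : Equiv.Perm ι)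
    (h : ∀ i, ∃ w : ℝ, 1 / 2 ≤ w ∧ p i * p (σ i) * p i = (w : ℂ) • p i)
    (h' : ∀ i, ∃ w : ℝ, 1 / 2 ≤ w ∧ p i * p (σ⁻¹ i) * p i = (w : ℂ) • p i) :
    IsUnit (compressedShift hp σ) := by
  obtain ⟨b, -, hb⟩ := isUnit_iff_exists.1 (isUnit_compressedShift_inv_mul hp σ h')
  obtain ⟨c, hc, -⟩ := isUnit_iff_exists.1
    (isUnit_compressedShift_inv_mul hp σ⁻¹ (by simpa using h))
  rw [inv_inv] at hc
  exact isUnit_iff_exists_and_exists.2 ⟨⟨_, (mul_assoc _ _ _).symm.trans hc⟩,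
    ⟨_, (mul_assoc _ _ _).trans hb⟩⟩

end Shift

lemma gmatZ_det : gmatZ.det = 1 := by
  simp [gmatZ, det_fin_three]

lemma isUnit_gmatZ_det : IsUnit gmatZ.det := by simp [gmatZ_det]

/-- The permutation of `ℤ³` induced by `gmatZ`. -/
noncomputable def gPerm : Equiv.Perm (Fin 3 → ℤ) where
  toFun := gmatZ.mulVec
  invFun := gmatZ⁻¹.mulVec
  left_inv k := by rw [mulVec_mulVec, nonsing_inv_mul _ isUnit_gmatZ_det, one_mulVec]
  right_inv k := by rw [mulVec_mulVec, mul_nonsing_inv _ isUnit_gmatZ_det, one_mulVec]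

lemma gPerm_dotProduct_nonneg (k : Fin 3 → ℤ) : 0 ≤ k ⬝ᵥ gPerm k := by
  have h : k ⬝ᵥ gPerm k = k 0 ^ 2 + (k 0 + k 1) ^ 2 + k 2 ^ 2 := by
    change k ⬝ᵥ gmatZ.mulVec k = _
    simp [gmatZ, dotProduct, mulVec, Fin.sum_univ_three]
    ring
  rw [h]
  positivity

lemma gPerm_eq_zero_iff (k : Fin 3 → ℤ) : gPerm k = 0 ↔ k = 0 := by
  rw [← gPerm.injective.eq_iff (a := k) (b := 0)]
  exact iff_of_eq (congrArg _ (mulVec_zero gmatZ).symm)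

/-- `g` has determinant `1`, hence induces a bijection of `ℤ³`; there are bounded operators
`P, T` on `H = ℓ²(ℤ³; ℂ²)` given by `(Pa)_k = p(k)·a_k` and `(Ta)_m = a_{g⁻¹m}`; `P` is an
orthogonal projection, `T` is unitary, and `D₁ = P·T·P + (1 − P)` is invertible. -/
theorem cat_map_operator_invertible :
    gmatZ.det = 1 ∧
    Function.Bijective (fun k : Fin 3 → ℤ => gmatZ.mulVec k) ∧
    ∃ P T : H →L[ℂ] H,
      (∀ a : H, ∀ k : Fin 3 → ℤ,
        (P a) k = (diracProj k).mulVec (a k)) ∧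
      (∀ a : H, ∀ m : Fin 3 → ℤ,
        (T a) m = a (gmatZ⁻¹.mulVec m)) ∧
      (P ∘L P = P ∧ IsSelfAdjoint P) ∧
      T ∈ unitary (H →L[ℂ] H) ∧
      IsUnit (P ∘L T ∘L P + (1 - P)) := by
  have hp (k : Fin 3 → ℤ) :
      IsStarProjection (toEuclideanCLM (n := Fin 2) (𝕜 := ℂ) (diracProj k)) :=
    (isStarProjection_diracProj k).map toEuclideanCLM
  have key {k l : Fin 3 → ℤ} (hkl : l = 0 → k = 0) (h : 0 ≤ k ⬝ᵥ l) :
      ∃ w : ℝ, 1 / 2 ≤ w ∧ toEuclideanCLM (n := Fin 2) (𝕜 := ℂ) (diracProj k) *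
        toEuclideanCLM (n := Fin 2) (𝕜 := ℂ) (diracProj l) *
        toEuclideanCLM (n := Fin 2) (𝕜 := ℂ) (diracProj k) =
        (w : ℂ) • toEuclideanCLM (n := Fin 2) (𝕜 := ℂ) (diracProj k) := by
    obtain ⟨w, hw, h⟩ := exists_diracProj_mul_mul hkl h
    exact ⟨w, hw, by rw [← map_mul, ← map_mul, h, map_smul]⟩
  have hg (k : Fin 3 → ℤ) := key (gPerm_eq_zero_iff k).1 (gPerm_dotProduct_nonneg k)
  have hg' (k : Fin 3 → ℤ) := key (k := k) (l := gPerm⁻¹ k)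
    (fun h => (gPerm.apply_symm_apply k).symm.trans ((gPerm_eq_zero_iff _).2 h))
    (by simpa [dotProduct_comm] using gPerm_dotProduct_nonneg (gPerm⁻¹ k))
  refine ⟨gmatZ_det, gPerm.bijective, diagProj hp, shiftCLM gPerm⁻¹, fun a k => ?_,
    fun a m => rfl, ⟨(isStarProjection_diagProj hp).isIdempotentElem.eq,
    (isStarProjection_diagProj hp).isSelfAdjoint⟩, shiftCLM_mem_unitary _,
    isUnit_compressedShift hp gPerm⁻¹ hg' hg⟩
  exact ofLp_toEuclideanCLM _ _
end
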